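/- arXiv:2304.03349 — 5 statements merged into one kernel-verified Lean document; each statement's English description precedes it below -/
import Mathlib

section
/- The difference of dilogarithms at √2−1 and 1−√2 admits the double-series representation Li₂(√2−1) − Li₂(1−√2) = π(π−1)/8 + 2·Σ_{n=1}^{∞} [ Σ_{k=n+1}^{∞} (−1)^k ( 1/(4k−1) − 1/(4k−3) ) ]². -/
open Real

/-- The dilogarithm, `Li₂(z) = ∑_{k=1}^∞ z^k / k²`. -/
noncomputable def Li2 (z : ℝ) : ℝ := ∑' k : ℕ, z ^ (k + 1) / ((k : ℝ) + 1) ^ 2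

/-- The inner tail sum `∑_{k=n+1}^∞ (−1)^k (1/(4k−1) − 1/(4k−3))`,
indexed so that `k = n + 1 + j`. -/
noncomputable def innerTail (n : ℕ) : ℝ :=
  ∑' j : ℕ, (-1 : ℝ) ^ (n + 1 + j) *
    (1 / (4 * ((n : ℝ) + 1 + j) - 1) - 1 / (4 * ((n : ℝ) + 1 + j) - 3))

theorem cos_quarter_ge {x : ℝ} (hx : x ∈ Set.Icc (-π) π) : 1 / 2 ≤ cos (x / 4) := by
  rw [← cos_pi_div_three, ← cos_abs (x / 4)]
  have : |x| ≤ π := abs_le.2 hx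
  have h4 : |x / 4| = |x| / 4 := by rw [abs_div]; norm_num
  apply cos_le_cos_of_nonneg_of_le_pi (abs_nonneg _) <;> linarith [pi_pos]

theorem cos_quarter_ne_zero {x : ℝ} (hx : x ∈ Set.Icc (-π) π) : cos (x / 4) ≠ 0 := by
  exact (one_half_pos.trans_le (cos_quarter_ge hx)).ne'

/-- The `n`-th Fourier cosine coefficient of `x ↦ 1 / cos (x / 4)` on `[-π, π]`. -/
noncomputable def secCoeff (n : ℤ) : ℝ :=
  1 / (2 * π) * ∫ x in (-π)..π, cos (n * x) / cos (x / 4)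

theorem intervalIntegrable_div_cos_quarter {f : ℝ → ℝ} (hf : Continuous f) :
    IntervalIntegrable (fun x => f x / cos (x / 4)) MeasureTheory.volume (-π) π := by
  apply ContinuousOn.intervalIntegrable
  rw [Set.uIcc_of_le (by linarith [pi_pos])]
  exact hf.continuousOn.div (by fun_prop) fun x hx => cos_quarter_ne_zero hx

theorem secCoeff_neg (n : ℤ) : secCoeff (-n) = secCoeff n := by
  simp [secCoeff]

theorem integral_cos_mul_symm {s : ℝ} (hs : s ≠ 0) :
    ∫ x in (-π)..π, cos (s * x) = 2 * sin (s * π) / s := by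
  rw [intervalIntegral.integral_comp_mul_left (fun x => cos x) hs, integral_cos, mul_neg, sin_neg,
    smul_eq_mul]
  field_simp
  ring

theorem secCoeff_sub_succ (n : ℕ) :
    secCoeff n - secCoeff (n + 1 : ℕ) =
      4 * √2 / π * ((-1) ^ (n + 1) * (1 / (4 * (n + 1 : ℝ) - 1) - 1 / (4 * (n + 1 : ℝ) - 3))) := by
  have hn : (0 : ℝ) ≤ n := n.cast_nonneg
  have key : ∀ x ∈ Set.uIcc (-π) π,
      cos ((n : ℤ) * x) / cos (x / 4) - cos (((n + 1 : ℕ) : ℤ) * x) / cos (x / 4) =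
        2 * (cos ((n + 1 / 4 : ℝ) * x) - cos ((n + 3 / 4 : ℝ) * x)) := by
    intro x hx
    rw [Set.uIcc_of_le (by linarith [pi_pos])] at hx
    have h0 := cos_quarter_ne_zero hx
    rw [← sub_div, div_eq_iff h0, cos_sub_cos, cos_sub_cos]
    push_cast
    have e1 : (n * x - (n + 1) * x) / 2 = -(2 * (x / 4)) := by ring
    have e2 : ((n + 1 / 4 : ℝ) * x - (n + 3 / 4 : ℝ) * x) / 2 = -(x / 4) := by ring
    have e3 : ((n + 1 / 4 : ℝ) * x + (n + 3 / 4 : ℝ) * x) / 2 = (n * x + (n + 1) * x) / 2 := by ring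
    rw [e1, e2, e3, sin_neg, sin_neg, sin_two_mul]
    ring
  have hsin : ∀ t : ℝ, sin (n * π + t) = (-1) ^ n * sin t := fun t => by
    rw [add_comm, sin_add_nat_mul_pi]
  have h34 : sin (3 / 4 * π) = √2 / 2 := by
    rw [← sin_pi_sub, ← sin_pi_div_four]; congr 1; ring
  have h14 : sin (1 / 4 * π) = √2 / 2 := by
    rw [← sin_pi_div_four]; congr 1; ring
  rw [secCoeff, secCoeff, ← mul_sub, ← intervalIntegral.integral_sub
    (intervalIntegrable_div_cos_quarter (by fun_prop))
    (intervalIntegrable_div_cos_quarter (by fun_prop)),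
    intervalIntegral.integral_congr key, intervalIntegral.integral_const_mul,
    intervalIntegral.integral_sub (Continuous.intervalIntegrable (by fun_prop) _ _)
      (Continuous.intervalIntegrable (by fun_prop) _ _),
    integral_cos_mul_symm (by positivity), integral_cos_mul_symm (by positivity),
    add_mul, add_mul, hsin, hsin, h34, h14]
  have h1 : 4 * (n + 1 : ℝ) - 1 ≠ 0 := by linarith
  have h2 : 4 * (n + 1 : ℝ) - 3 ≠ 0 := by linarith
  have h3 : 4 * (n : ℝ) + 1 ≠ 0 := by linarith
  have h4 : 4 * (n : ℝ) + 3 ≠ 0 := by linarith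
  have h5 : 4 * (n + 1 : ℝ) - 1 = 4 * n + 3 := by ring
  have h6 : 4 * (n + 1 : ℝ) - 3 = 4 * n + 1 := by ring
  have h7 : (n + 1 / 4 : ℝ) = (4 * n + 1) / 4 := by ring
  have h8 : (n + 3 / 4 : ℝ) = (4 * n + 3) / 4 := by ring
  rw [h5, h6, h7, h8, pow_succ]
  field_simp
  ring

theorem secCoeff_zero : secCoeff 0 = 4 / π * log (1 + √2) := by
  have hs : √2 ^ 2 = 2 := sq_sqrt (by norm_num)
  have hs1 : 1 < √2 := by nlinarith [sqrt_nonneg 2]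
  have hs2 : √2 < 2 := by nlinarith [sqrt_nonneg 2]
  have hderiv : ∀ x ∈ Set.uIcc (-π) π, HasDerivAt
      (fun x : ℝ => 2 * (log (1 + sin (x / 4)) - log (1 - sin (x / 4))))
      (cos ((0 : ℤ) * x) / cos (x / 4)) x := by
    intro x hx
    rw [Set.uIcc_of_le (by linarith [pi_pos])] at hx
    have h0 := cos_quarter_ne_zero hx
    have hsq := sin_sq_add_cos_sq (x / 4)
    have hp : 1 + sin (x / 4) ≠ 0 := fun h => h0 (by
      have : sin (x / 4) = -1 := by linarith
      rw [this] at hsq; nlinarith)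
    have hm : 1 - sin (x / 4) ≠ 0 := fun h => h0 (by
      have : sin (x / 4) = 1 := by linarith
      rw [this] at hsq; nlinarith)
    have hd : HasDerivAt (fun x : ℝ => sin (x / 4)) (cos (x / 4) * (1 / 4)) x :=
      (hasDerivAt_sin _).comp x ((hasDerivAt_id x).div_const 4)
    convert! (((hd.const_add 1).log hp).sub ((hd.const_sub 1).log hm)).const_mul 2 using 1
    simp only [Int.cast_zero, zero_mul, cos_zero]
    field_simp
    nlinarith
  have hint := intervalIntegrable_div_cos_quarter (f := fun x => cos ((0 : ℤ) * x)) (by fun_prop)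
  rw [secCoeff, intervalIntegral.integral_eq_sub_of_hasDerivAt hderiv hint, neg_div, sin_neg,
    sin_pi_div_four]
  have h1 : log (1 + √2 / 2) - log (1 - √2 / 2) = 2 * log (1 + √2) := by
    rw [← log_div (by positivity) (by linarith), two_mul, ← log_mul (by positivity) (by positivity)]
    congr 1
    rw [div_eq_iff (by linarith)]
    nlinarith
  rw [sub_neg_eq_add, ← sub_eq_add_neg, ← neg_sub (log (1 + √2 / 2)), h1]
  field_simp
  ring

theorem fourierCoeffOn_sec (h : -π < π) (n : ℤ) :
    fourierCoeffOn h (fun x : ℝ => ((1 / cos (x / 4) : ℝ) : ℂ)) n = (secCoeff n : ℂ) := by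
  have hodd : ∫ x in (-π)..π, sin (n * x) / cos (x / 4) = 0 := by
    have := intervalIntegral.integral_comp_neg (a := -π) (b := π)
      fun x => sin (n * x) / cos (x / 4)
    simp only [mul_neg, sin_neg, neg_div, cos_neg, intervalIntegral.integral_neg, neg_neg] at this
    linarith
  have key : ∀ x ∈ Set.uIcc (-π) π,
      fourier (-n) (x : AddCircle (π - -π)) • ((1 / cos (x / 4) : ℝ) : ℂ) =
        ((cos (n * x) / cos (x / 4) : ℝ) : ℂ) -
          ((sin (n * x) / cos (x / 4) : ℝ) : ℂ) * Complex.I := by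
    intro x _
    have hπ : (π : ℂ) ≠ 0 := by exact_mod_cast pi_ne_zero
    have : 2 * π * Complex.I * ((-n : ℤ) : ℂ) * x / ((π - -π : ℝ) : ℂ) =
        ((-(n * x) : ℝ) : ℂ) * Complex.I := by
      push_cast
      field_simp
      ring
    rw [fourier_coe_apply, this, Complex.exp_mul_I, ← Complex.ofReal_cos, ← Complex.ofReal_sin,
      cos_neg, sin_neg]
    push_cast
    rw [smul_eq_mul]
    ring
  have hcast : ∀ {f : ℝ → ℝ}, Continuous f → IntervalIntegrable
      (fun x => ((f x / cos (x / 4) : ℝ) : ℂ)) MeasureTheory.volume (-π) π := fun hf =>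
    have h := intervalIntegrable_div_cos_quarter hf
    ⟨h.1.ofReal, h.2.ofReal⟩
  rw [fourierCoeffOn_eq_integral, intervalIntegral.integral_congr key,
    intervalIntegral.integral_sub, intervalIntegral.integral_mul_const,
    intervalIntegral.integral_ofReal, intervalIntegral.integral_ofReal, hodd, secCoeff]
  · simp only [Complex.real_smul]
    push_cast
    ring
  · exact hcast (f := fun x => cos (n * x)) (by fun_prop)
  · exact (hcast (f := fun x => sin (n * x)) (by fun_prop)).mul_const _

theorem integral_sec_sq_quarter : ∫ x in (-π)..π, (1 / cos (x / 4)) ^ 2 = 8 := by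
  have hderiv : ∀ x ∈ Set.uIcc (-π) π, HasDerivAt (fun x : ℝ => 4 * tan (x / 4))
      ((1 / cos (x / 4)) ^ 2) x := by
    intro x hx
    rw [Set.uIcc_of_le (by linarith [pi_pos])] at hx
    have h0 := cos_quarter_ne_zero hx
    convert! ((hasDerivAt_tan h0).comp x ((hasDerivAt_id x).div_const 4)).const_mul 4 using 1
    field_simp
  rw [intervalIntegral.integral_eq_sub_of_hasDerivAt hderiv, neg_div, tan_neg, tan_pi_div_four]
  · norm_num
  · apply ContinuousOn.intervalIntegrable
    rw [Set.uIcc_of_le (by linarith [pi_pos])]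
    exact (continuousOn_const.div (by fun_prop) fun x hx => cos_quarter_ne_zero hx).pow 2

theorem hasSum_secCoeff_sq : HasSum (fun n : ℤ => secCoeff n ^ 2) (4 / π) := by
  have h : -π < π := by linarith [pi_pos]
  have hmem : MeasureTheory.MemLp (fun x : ℝ => ((1 / cos (x / 4) : ℝ) : ℂ)) 2
      (MeasureTheory.volume.restrict (Set.Ioc (-π) π)) := by
    refine MeasureTheory.MemLp.of_bound
      (Measurable.aestronglyMeasurable (by fun_prop)) 2 ?_
    refine (MeasureTheory.ae_restrict_mem measurableSet_Ioc).mono fun x hx => ?_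
    have := cos_quarter_ge (Set.Ioc_subset_Icc_self hx)
    rw [Complex.norm_real, norm_of_nonneg (by positivity), div_le_iff₀ (by linarith)]
    linarith
  have := hasSum_sq_fourierCoeffOn h hmem
  simp only [fourierCoeffOn_sec, Complex.norm_real, norm_eq_abs, sq_abs,
    integral_sec_sq_quarter] at this
  convert! this using 1
  rw [smul_eq_mul]
  field_simp
  ring

theorem hasSum_secCoeff_succ_sq :
    HasSum (fun n : ℕ => secCoeff (n + 1 : ℕ) ^ 2) (2 / π - 8 / π ^ 2 * log (1 + √2) ^ 2) := by
  have h := hasSum_secCoeff_sq.nat_add_neg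
  simp only [secCoeff_neg, secCoeff_zero] at h
  rw [← hasSum_nat_add_iff' 1] at h
  convert! h.div_const 2 using 1
  · ext n; ring
  · simp [secCoeff_zero]
    ring

theorem tendsto_secCoeff : Filter.Tendsto (fun n : ℕ => secCoeff n) Filter.atTop (nhds 0) := by
  have h := hasSum_secCoeff_succ_sq.summable.tendsto_atTop_zero
  rw [Filter.tendsto_add_atTop_iff_nat (f := fun n : ℕ => secCoeff n ^ 2) 1] at h
  rw [tendsto_zero_iff_abs_tendsto_zero]
  simpa [sqrt_sq_eq_abs, Function.comp_def] using h.sqrt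

theorem summable_one_div_succ_sq : Summable fun k : ℕ => 1 / ((k : ℝ) + 1) ^ 2 := by
  simpa using (summable_nat_add_iff 1).2 (Real.summable_one_div_nat_pow.2 one_lt_two)

theorem innerTail_eq (n : ℕ) : innerTail n = π * √2 / 8 * secCoeff n := by
  have hterm : ∀ j : ℕ, (-1 : ℝ) ^ (n + 1 + j) *
      (1 / (4 * ((n : ℝ) + 1 + j) - 1) - 1 / (4 * ((n : ℝ) + 1 + j) - 3)) =
      π * √2 / 8 * (secCoeff (n + j : ℕ) - secCoeff (n + (j + 1) : ℕ)) := by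
    intro j
    rw [← add_assoc n, secCoeff_sub_succ]
    push_cast
    have hs : √2 ^ 2 = 2 := sq_sqrt (by norm_num)
    have e1 : (n : ℝ) + 1 + j = n + j + 1 := by ring
    have e2 : n + 1 + j = n + j + 1 := by ring
    have e3 : π * √2 / 8 * (4 * √2 / π) = 1 := by
      field_simp; linarith
    rw [e1, e2, ← mul_assoc (π * √2 / 8), e3, one_mul]
  apply HasSum.tsum_eq
  rw [Summable.hasSum_iff_tendsto_nat]
  · simp only [hterm, ← Finset.mul_sum]
    apply Filter.Tendsto.const_mul
    simp only [Finset.sum_range_sub' fun j : ℕ => secCoeff (n + j : ℕ)]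
    have := tendsto_secCoeff.comp (Filter.tendsto_add_atTop_nat n)
    simpa [Function.comp_def, add_comm] using this.const_sub (secCoeff n)
  · refine Summable.of_norm_bounded (summable_one_div_succ_sq.mul_left 2) fun j => ?_
    have hn : (0 : ℝ) ≤ n := n.cast_nonneg
    have hj : (0 : ℝ) ≤ j := j.cast_nonneg
    have h1 : 0 < 4 * ((n : ℝ) + 1 + j) - 1 := by linarith
    have h3 : 0 < 4 * ((n : ℝ) + 1 + j) - 3 := by linarith
    rw [norm_mul, norm_pow, norm_neg, norm_one, one_pow, one_mul, div_sub_div _ _ h1.ne' h3.ne',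
      norm_div, norm_eq_abs, norm_eq_abs, abs_of_pos (mul_pos h1 h3)]
    have e : |1 * (4 * ((n : ℝ) + 1 + j) - 3) - (4 * ((n : ℝ) + 1 + j) - 1) * 1| = 2 := by
      rw [abs_eq (by norm_num)]; right; ring
    rw [e, mul_one_div]
    gcongr
    nlinarith

theorem two_mul_tsum_innerTail_sq :
    2 * ∑' n : ℕ, innerTail (n + 1) ^ 2 = π / 8 - log (1 + √2) ^ 2 / 2 := by
  have hs : √2 ^ 2 = 2 := sq_sqrt (by norm_num)
  have h := hasSum_secCoeff_succ_sq.mul_left ((π * √2 / 8) ^ 2)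
  simp only [innerTail_eq, mul_pow _ (secCoeff _)]
  rw [h.tsum_eq, div_pow, mul_pow, hs]
  field_simp
  ring

theorem norm_Li2_term_le {z : ℝ} (hz : |z| ≤ 1) (k : ℕ) :
    ‖z ^ (k + 1) / ((k : ℝ) + 1) ^ 2‖ ≤ 1 / ((k : ℝ) + 1) ^ 2 := by
  rw [norm_div, norm_pow, norm_eq_abs, norm_of_nonneg (by positivity : 0 ≤ ((k : ℝ) + 1) ^ 2)]
  gcongr
  exact pow_le_one₀ (abs_nonneg z) hz

theorem summable_Li2_term {z : ℝ} (hz : |z| ≤ 1) :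
    Summable fun k : ℕ => z ^ (k + 1) / ((k : ℝ) + 1) ^ 2 :=
  summable_one_div_succ_sq.of_norm_bounded (norm_Li2_term_le hz)

theorem continuousOn_Li2 : ContinuousOn Li2 (Set.Icc (-1) 1) :=
  continuousOn_tsum (fun k => by fun_prop) summable_one_div_succ_sq
    fun k _ hx => norm_Li2_term_le (abs_le.2 hx) k

theorem Li2_one : Li2 1 = π ^ 2 / 6 := by
  have h := (hasSum_nat_add_iff' 1).2 hasSum_zeta_two
  simpa [Li2] using h.tsum_eq

theorem Li2_add_Li2_neg {z : ℝ} (hz : |z| ≤ 1) : Li2 z + Li2 (-z) = Li2 (z ^ 2) / 2 := by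
  have h1 := (summable_Li2_term hz).hasSum
  have h2 := (summable_Li2_term (z := -z) (by rwa [abs_neg])).hasSum
  have hz2 : |z ^ 2| ≤ 1 := by rw [abs_pow]; exact pow_le_one₀ (abs_nonneg z) hz
  have h3 := (summable_Li2_term hz2).hasSum
  have he : HasSum (fun k : ℕ => z ^ (2 * k + 1) / (((2 * k : ℕ) : ℝ) + 1) ^ 2 +
      (-z) ^ (2 * k + 1) / (((2 * k : ℕ) : ℝ) + 1) ^ 2) 0 := by
    convert! hasSum_zero (α := ℝ) (β := ℕ) using 2 with k
    rw [Odd.neg_pow ⟨k, rfl⟩]; ring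
  have ho : HasSum (fun k : ℕ => z ^ (2 * k + 1 + 1) / (((2 * k + 1 : ℕ) : ℝ) + 1) ^ 2 +
      (-z) ^ (2 * k + 1 + 1) / (((2 * k + 1 : ℕ) : ℝ) + 1) ^ 2) (Li2 (z ^ 2) / 2) := by
    convert! h3.div_const 2 using 2 with k
    rw [Even.neg_pow ⟨k + 1, by ring⟩, ← pow_mul]
    push_cast
    have e : 2 * k + 1 + 1 = 2 * (k + 1) := by ring
    rw [e]
    field_simp
    ring
  have h := (HasSum.even_add_odd (f := fun k : ℕ => z ^ (k + 1) / ((k : ℝ) + 1) ^ 2 +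
      (-z) ^ (k + 1) / ((k : ℝ) + 1) ^ 2) he ho)
  rw [zero_add] at h
  exact (h1.add h2).unique h

theorem hasDerivAt_Li2 {z : ℝ} (hz : |z| < 1) (h0 : z ≠ 0) :
    HasDerivAt Li2 (-log (1 - z) / z) z := by
  obtain ⟨r, hzr, hr⟩ := exists_between hz
  have hr0 : 0 < r := (abs_nonneg z).trans_lt hzr
  have h := hasDerivAt_tsum_of_isPreconnected
    (g := fun (k : ℕ) (z : ℝ) => z ^ (k + 1) / ((k : ℝ) + 1) ^ 2)
    (g' := fun (k : ℕ) (z : ℝ) => z ^ k / ((k : ℝ) + 1))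
    (t := Set.Ioo (-r) r) (y₀ := 0) (y := z)
    (summable_geometric_of_lt_one hr0.le hr) isOpen_Ioo isPreconnected_Ioo
    (fun k y _ => by
      convert! (hasDerivAt_pow (k + 1) y).div_const (((k : ℝ) + 1) ^ 2) using 1
      push_cast [Nat.add_sub_cancel]
      field_simp)
    (fun k y hy => by
      rw [norm_div, norm_pow, norm_eq_abs, norm_of_nonneg (by positivity : 0 ≤ (k : ℝ) + 1)]
      have hy' : |y| ≤ r := (abs_lt.2 hy).le
      calc |y| ^ k / ((k : ℝ) + 1) ≤ |y| ^ k :=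
            div_le_self (by positivity) (by linarith [k.cast_nonneg (α := ℝ)])
        _ ≤ r ^ k := by gcongr)
    ⟨by linarith, hr0⟩ (summable_Li2_term (by simp)) (abs_lt.1 hzr)
  convert! h using 1
  rw [← (hasSum_pow_div_log_of_abs_lt_one hz).tsum_eq, ← tsum_div_const]
  congr 1 with k
  rw [pow_succ]
  field_simp

theorem hasDerivAt_Li2_sub_Li2_neg {z : ℝ} (hz : |z| < 1) (h0 : z ≠ 0) :
    HasDerivAt (fun z => Li2 z - Li2 (-z)) ((log (1 + z) - log (1 - z)) / z) z := by
  have h := (hasDerivAt_Li2 (z := -z) (by rwa [abs_neg]) (neg_ne_zero.2 h0)).comp z (hasDerivAt_neg z)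
  convert! (hasDerivAt_Li2 hz h0).sub h using 1
  rw [sub_neg_eq_add]
  field_simp
  ring

open Filter Topology in
/-- Landen's reflection formula for the Legendre chi function `(Li₂(x) - Li₂(-x)) / 2`. -/
theorem Li2_sub_Li2_neg_landen {x : ℝ} (hx : x ∈ Set.Ioo (0 : ℝ) 1) :
    Li2 x - Li2 (-x) + (Li2 ((1 - x) / (1 + x)) - Li2 (-((1 - x) / (1 + x)))) =
      π ^ 2 / 4 + log x * (log (1 + x) - log (1 - x)) := by
  let g : ℝ → ℝ := fun z => Li2 z - Li2 (-z)
  let F : ℝ → ℝ := fun x =>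
    g x + g ((1 - x) / (1 + x)) - log x * (log (1 + x) - log (1 - x))
  have hF : ∀ y ∈ Set.Ioo (0 : ℝ) 1, HasDerivAt F 0 y := by
    intro y ⟨hy0, hy1⟩
    have hp : 0 < 1 + y := by linarith
    have hm : 0 < 1 - y := by linarith
    have hw0 : 0 < (1 - y) / (1 + y) := by positivity
    have hw1 : (1 - y) / (1 + y) < 1 := by rw [div_lt_one hp]; linarith
    have hw : HasDerivAt (fun x : ℝ => (1 - x) / (1 + x))
        ((-1 * (1 + y) - (1 - y) * 1) / (1 + y) ^ 2) y :=
      ((hasDerivAt_id y).const_sub 1).div ((hasDerivAt_id y).const_add 1) hp.ne'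
    have h1 := hasDerivAt_Li2_sub_Li2_neg (by rwa [abs_of_pos hy0]) hy0.ne'
    have h2 := (hasDerivAt_Li2_sub_Li2_neg (by rwa [abs_of_pos hw0]) hw0.ne').comp y hw
    have h3 := (hasDerivAt_log hy0.ne').mul
      ((((hasDerivAt_id y).const_add 1).log hp.ne').sub
        (((hasDerivAt_id y).const_sub 1).log hm.ne'))
    convert! (h1.add h2).sub h3 using 1
    have e1 : 1 + (1 - y) / (1 + y) = 2 / (1 + y) := by field_simp; ring
    have e2 : 1 - (1 - y) / (1 + y) = 2 * y / (1 + y) := by field_simp; ring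
    rw [e1, e2, log_div two_ne_zero hp.ne', log_div (by positivity) hp.ne',
      log_mul two_ne_zero hy0.ne']
    simp only [id, Pi.sub_apply]
    field_simp
    ring
  have hconst : ∀ y ∈ Set.Ioo (0 : ℝ) 1, F y = F x := fun y hy =>
    isOpen_Ioo.is_const_of_deriv_eq_zero isPreconnected_Ioo
      (fun z hz => (hF z hz).differentiableAt.differentiableWithinAt)
      (fun z hz => (hF z hz).deriv) hy hx
  have hg : ContinuousOn g (Set.Icc (-1) 1) :=
    continuousOn_Li2.sub (continuousOn_Li2.comp continuousOn_neg fun z hz =>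
      ⟨by linarith [hz.2], by linarith [hz.1]⟩)
  have hmem : ∀ᶠ y in 𝓝[>] (0 : ℝ), y ∈ Set.Ioo (0 : ℝ) 1 := Ioo_mem_nhdsGT one_pos
  have hg0 : Tendsto g (𝓝[>] 0) (𝓝 (g 0)) :=
    ((hg.continuousAt (Icc_mem_nhds (by norm_num) (by norm_num))).tendsto).mono_left
      nhdsWithin_le_nhds
  have hw : Tendsto (fun y : ℝ => (1 - y) / (1 + y)) (𝓝[>] 0) (𝓝[Set.Icc (-1) 1] 1) := by
    apply tendsto_nhdsWithin_of_tendsto_nhds_of_eventually_within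
    · have : ContinuousAt (fun y : ℝ => (1 - y) / (1 + y)) 0 := by
        apply ContinuousAt.div <;> first | fun_prop | norm_num
      simpa using this.tendsto.mono_left nhdsWithin_le_nhds
    · filter_upwards [hmem] with y hy
      have hp : 0 < 1 + y := by linarith [hy.1]
      exact ⟨by rw [le_div_iff₀ hp]; linarith, by rw [div_le_one hp]; linarith [hy.1]⟩
  have hg1 := (hg 1 (by norm_num)).tendsto.comp hw
  have hlog : Tendsto (fun y : ℝ => log y * (log (1 + y) - log (1 - y))) (𝓝[>] 0) (𝓝 0) := by
    have hd : HasDerivAt (fun y : ℝ => log (1 + y) - log (1 - y)) 2 0 := by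
      convert! (((hasDerivAt_id (0 : ℝ)).const_add 1).log (by norm_num)).sub
        (((hasDerivAt_id (0 : ℝ)).const_sub 1).log (by norm_num)) using 1
      norm_num
    have hs := (hasDerivAt_iff_tendsto_slope.1 hd).mono_left
      (nhdsWithin_mono 0 fun y (hy : 0 < y) => hy.ne')
    have hx := (continuous_mul_log.tendsto 0).mono_left (nhdsWithin_le_nhds (s := Set.Ioi 0))
    have := hx.mul hs
    simp only [zero_mul] at this
    refine this.congr' ?_
    filter_upwards [hmem] with y hy
    have := hy.1.ne'
    rw [slope_def_field]
    simp
    field_simp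
  have hlim : Tendsto F (𝓝[>] 0) (𝓝 (g 0 + g 1 - 0)) := (hg0.add hg1).sub hlog
  have hFx : F x = g 0 + g 1 - 0 :=
    tendsto_nhds_unique (tendsto_const_nhds.congr' (by
      filter_upwards [hmem] with y hy using (hconst y hy).symm)) hlim
  have h1 : Li2 1 + Li2 (-1) = Li2 1 / 2 := by simpa using Li2_add_Li2_neg (z := 1) (by simp)
  have hval : g 0 + g 1 = π ^ 2 / 4 := by
    simp only [g, neg_zero, sub_self, zero_add]
    rw [Li2_one] at *
    linarith
  simp only [F, g] at hFx hval
  linarith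

theorem Li2_sqrt_two_sub_one_sub :
    Li2 (√2 - 1) - Li2 (1 - √2) = π ^ 2 / 8 - log (1 + √2) ^ 2 / 2 := by
  have hs : √2 ^ 2 = 2 := sq_sqrt (by norm_num)
  have hs1 : 1 < √2 := by nlinarith [sqrt_nonneg 2]
  have hs2 : √2 < 2 := by nlinarith [sqrt_nonneg 2]
  have h := Li2_sub_Li2_neg_landen (x := √2 - 1) ⟨by linarith, by linarith⟩
  have e1 : (1 - (√2 - 1)) / (1 + (√2 - 1)) = √2 - 1 := by
    rw [div_eq_iff (by linarith)]; linarith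
  have e2 : log (√2 - 1) = -log (1 + √2) := by
    rw [← log_inv]; congr 1; exact eq_inv_of_mul_eq_one_left (by linarith)
  have e3 : log (1 + (√2 - 1)) - log (1 - (√2 - 1)) = log (1 + √2) := by
    rw [← log_div (by linarith) (by linarith)]; congr 1
    rw [div_eq_iff (by linarith)]; linarith
  rw [e1, e2, e3, neg_sub] at h
  linarith

theorem stmt_0 :
    Li2 (Real.sqrt 2 - 1) - Li2 (1 - Real.sqrt 2) =
      Real.pi * (Real.pi - 1) / 8 + 2 * ∑' n : ℕ, (innerTail (n + 1)) ^ 2 := by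
  rw [Li2_sqrt_two_sub_one_sub, two_mul_tsum_innerTail_sq]
  ring
end

section
/- Li₂(√2−1) − Li₂(1−√2) = 4·∫₀¹ √(1−x²) · arcsin((√2−1)x) dx + (1+√2)·[1 + ln(2−√2) − (ln 2)/2]. -/
open Real

/-- On `(-1, 1)` the dilogarithm is differentiable with `z * Li₂'(z) = -log (1 - z)`. -/
theorem Li2_hasDerivAt {z : ℝ} (hz : |z| < 1) :
    ∃ d : ℝ, HasDerivAt Li2 d z ∧ z * d = -Real.log (1 - z) := by
  obtain ⟨r, hzr, hr1⟩ := exists_between hz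
  have hr0 : 0 ≤ r := (abs_nonneg z).trans hzr.le
  refine ⟨∑' k : ℕ, z ^ k / ((k : ℝ) + 1), ?_, ?_⟩
  · have hmem : z ∈ Metric.ball (0 : ℝ) r := by simpa using hzr
    unfold Li2
    refine hasDerivAt_tsum_of_isPreconnected (u := fun k : ℕ => r ^ k)
      (g := fun (k : ℕ) (z : ℝ) => z ^ (k + 1) / ((k : ℝ) + 1) ^ 2)
      (g' := fun (k : ℕ) (z : ℝ) => z ^ k / ((k : ℝ) + 1)) (t := Metric.ball (0 : ℝ) r) (y₀ := 0)
      (summable_geometric_of_lt_one hr0 hr1) Metric.isOpen_ball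
      (convex_ball (0 : ℝ) r).isPreconnected ?_ ?_ ?_ ?_ hmem
    · intro n y _
      have hn : (n : ℝ) + 1 ≠ 0 := by positivity
      convert! (hasDerivAt_pow (n + 1) y).div_const (((n : ℝ) + 1) ^ 2) using 1
      push_cast
      field_simp
    · intro n y hy
      have hy' : |y| ≤ r := by simpa using (Metric.mem_ball.1 hy).le
      rw [norm_div, norm_pow, Real.norm_eq_abs, Real.norm_eq_abs,
        abs_of_nonneg (by positivity : (0 : ℝ) ≤ (n : ℝ) + 1)]
      refine (div_le_self (by positivity) (by linarith [Nat.cast_nonneg (α := ℝ) n])).trans ?_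
      gcongr
    · simpa using (abs_nonneg z).trans_lt hzr
    · simp [summable_zero]
  · rw [← tsum_mul_left, ← (Real.hasSum_pow_div_log_of_abs_lt_one hz).tsum_eq]
    refine tsum_congr fun k => ?_
    rw [pow_succ]
    ring

theorem integral_mul_sqrt_div_sqrt {t : ℝ} (ht0 : 0 < t) (ht1 : t < 1) :
    ∫ x in (0 : ℝ)..1, √(1 - x ^ 2) * (x / √(1 - (t * x) ^ 2)) =
      1 / (2 * t ^ 2) - (1 - t ^ 2) / (4 * t ^ 3) * (Real.log (1 + t) - Real.log (1 - t)) := by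
  have hpos : ∀ x ∈ Set.Icc (0 : ℝ) 1, 0 < 1 - (t * x) ^ 2 := by
    rintro x ⟨h0, h1⟩
    have : t * x < 1 := by nlinarith
    have : 0 ≤ t * x := by positivity
    nlinarith
  have hadd : ∀ x ∈ Set.Icc (0 : ℝ) 1, t * √(1 - x ^ 2) + √(1 - (t * x) ^ 2) ≠ 0 := by
    intro x hx
    have := Real.sqrt_pos.2 (hpos x hx)
    positivity
  have key := intervalIntegral.integral_eq_sub_of_hasDerivAt_of_le (a := 0) (b := 1)
    (f := fun x => -(√(1 - x ^ 2) * √(1 - (t * x) ^ 2)) / (2 * t ^ 2) +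
      (1 - t ^ 2) / (2 * t ^ 3) * Real.log (t * √(1 - x ^ 2) + √(1 - (t * x) ^ 2)))
    (f' := fun x => √(1 - x ^ 2) * (x / √(1 - (t * x) ^ 2))) zero_le_one ?_ ?_ ?_
  · rw [key]
    have h1 : Real.log (√(1 - t ^ 2)) = (Real.log (1 + t) + Real.log (1 - t)) / 2 := by
      rw [Real.log_sqrt (by nlinarith), ← Real.log_mul (by linarith) (by linarith)]
      ring_nf
    simp [h1]
    rw [add_comm t 1]
    field_simp
    ring
  · refine ContinuousOn.add (by fun_prop) (continuousOn_const.mul (ContinuousOn.log ?_ hadd))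
    fun_prop
  · rintro x ⟨hx0, hx1⟩
    have hw : 0 < 1 - x ^ 2 := by nlinarith
    have hv := hpos x ⟨hx0.le, hx1.le⟩
    have hwd : HasDerivAt (fun x : ℝ => √(1 - x ^ 2)) (-x / √(1 - x ^ 2)) x := by
      convert! (((hasDerivAt_id x).pow 2).const_sub 1).sqrt hw.ne' using 1
      simp
      field_simp
    have hvd : HasDerivAt (fun x : ℝ => √(1 - (t * x) ^ 2))
        (-(t ^ 2 * x) / √(1 - (t * x) ^ 2)) x := by
      convert! ((((hasDerivAt_id x).const_mul t).pow 2).const_sub 1).sqrt hv.ne' using 1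
      simp
      field_simp
    have hl := ((hwd.const_mul t).add hvd).log (hadd x ⟨hx0.le, hx1.le⟩)
    have hn := hadd x ⟨hx0.le, hx1.le⟩
    convert! (((hwd.mul hvd).neg).div_const (2 * t ^ 2)).add
      (hl.const_mul ((1 - t ^ 2) / (2 * t ^ 3))) using 1
    have hws := Real.sq_sqrt hw.le
    have hvs := Real.sq_sqrt hv.le
    have hw0 := Real.sqrt_pos.2 hw
    have hv0 := Real.sqrt_pos.2 hv
    simp only [Pi.add_apply]
    set w := √(1 - x ^ 2)
    set v := √(1 - (t * x) ^ 2)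
    have e : (t * (-x / w) + -(t ^ 2 * x) / v) / (t * w + v) = -(t * x) / (w * v) := by
      field_simp
      ring
    rw [e]
    field_simp
    have : v ^ 2 = 1 - t ^ 2 + t ^ 2 * w ^ 2 := by rw [hws, hvs]; ring
    linear_combination (-1) * this
  · refine ContinuousOn.intervalIntegrable_of_Icc zero_le_one ?_
    refine ContinuousOn.mul (by fun_prop) (ContinuousOn.div (by fun_prop) (by fun_prop) ?_)
    exact fun x hx => (Real.sqrt_pos.2 (hpos x hx)).ne'

theorem integral_sqrt_mul_arcsin {a : ℝ} (ha0 : 0 < a) (ha1 : a < 1) :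
    ∫ x in (0 : ℝ)..1, √(1 - x ^ 2) * Real.arcsin (a * x) =
      ∫ t in (0 : ℝ)..a, ∫ x in (0 : ℝ)..1, √(1 - x ^ 2) * (x / √(1 - (t * x) ^ 2)) := by
  have hpos : ∀ x ∈ Set.Icc (0 : ℝ) 1, ∀ t ∈ Set.Icc (0 : ℝ) a, 0 < 1 - (t * x) ^ 2 := by
    rintro x ⟨h0, h1⟩ t ⟨h2, h3⟩
    have : t * x < 1 := by nlinarith
    have : 0 ≤ t * x := by positivity
    nlinarith
  have hswap := MeasureTheory.intervalIntegral_intervalIntegral_swap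
    (F := fun x t => √(1 - x ^ 2) * (x / √(1 - (t * x) ^ 2))) (a := 0) (b := 1) (c := 0) (d := a) ?_
  · rw [← hswap]
    refine intervalIntegral.integral_congr fun x hx => ?_
    rw [Set.uIcc_of_le zero_le_one] at hx
    simp only [intervalIntegral.integral_const_mul]
    congr 1
    rw [intervalIntegral.integral_eq_sub_of_hasDerivAt_of_le (f := fun t => Real.arcsin (t * x))
      ha0.le]
    · simp
    · fun_prop
    · intro t ht
      have h := hpos x hx t ⟨ht.1.le, ht.2.le⟩
      convert! (Real.hasDerivAt_arcsin (x := t * x) ?_ ?_).comp t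
        ((hasDerivAt_id t).mul_const x) using 1
      · ring
      · intro h'; rw [h'] at h; norm_num at h
      · intro h'; rw [h'] at h; norm_num at h
    · refine ContinuousOn.intervalIntegrable_of_Icc ha0.le ?_
      refine ContinuousOn.div (by fun_prop) (by fun_prop) ?_
      exact fun t ht => (Real.sqrt_pos.2 (hpos x hx t ht)).ne'
  · have hsub : Set.uIoc (0 : ℝ) 1 ×ˢ Set.uIoc 0 a ⊆ Set.Icc (0 : ℝ) 1 ×ˢ Set.Icc 0 a := by
      rw [Set.uIoc_of_le zero_le_one, Set.uIoc_of_le ha0.le]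
      exact Set.prod_mono Set.Ioc_subset_Icc_self Set.Ioc_subset_Icc_self
    refine MeasureTheory.IntegrableOn.mono_set
      (ContinuousOn.integrableOn_compact (isCompact_Icc.prod isCompact_Icc) ?_) hsub
    unfold Function.uncurry
    refine ContinuousOn.mul (by fun_prop) (ContinuousOn.div (by fun_prop) (by fun_prop) ?_)
    exact fun p hp => (Real.sqrt_pos.2 (hpos p.1 hp.1 p.2 hp.2)).ne'

theorem Li2_sub_Li2_neg_eq {a : ℝ} (ha0 : 0 < a) (ha1 : a < 1) :
    Li2 a - Li2 (-a) =
      4 * (∫ x in (0 : ℝ)..1, √(1 - x ^ 2) * Real.arcsin (a * x)) + 1 / a -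
        (1 - a ^ 2) / (2 * a ^ 2) * (Real.log (1 + a) - Real.log (1 - a)) := by
  let G : ℝ → ℝ := fun t => Li2 t - Li2 (-t) -
    (1 / t - (1 - t ^ 2) / (2 * t ^ 2) * (Real.log (1 + t) - Real.log (1 - t)))
  have hLi : ∀ t : ℝ, |t| < 1 → ∃ d, HasDerivAt (fun t => Li2 t - Li2 (-t)) d t ∧
      t * d = Real.log (1 + t) - Real.log (1 - t) := by
    intro t ht
    obtain ⟨d, hd, hd'⟩ := Li2_hasDerivAt ht
    obtain ⟨e, he, he'⟩ := Li2_hasDerivAt (z := -t) (by simpa using ht)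
    refine ⟨d + e, ?_, ?_⟩
    · convert! hd.sub (he.comp t (hasDerivAt_neg t)) using 1
      ring
    · rw [sub_neg_eq_add] at he'
      linarith
  have hG : ∀ t ∈ Set.Ioo (0 : ℝ) 1, HasDerivAt G
      (4 * ∫ x in (0 : ℝ)..1, √(1 - x ^ 2) * (x / √(1 - (t * x) ^ 2))) t := by
    rintro t ⟨h0, h1⟩
    obtain ⟨d, hd, hd'⟩ := hLi t (by rw [abs_of_pos h0]; exact h1)
    have hp : 1 + t ≠ 0 := by linarith
    have hm : 1 - t ≠ 0 := by linarith
    have hL := (((hasDerivAt_id t).const_add 1).log hp).sub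
      (((hasDerivAt_id t).const_sub 1).log hm)
    have hq := ((((hasDerivAt_id t).pow 2).const_sub 1).div
      (((hasDerivAt_id t).pow 2).const_mul 2) (by simpa using h0.ne'))
    convert! hd.sub (((hasDerivAt_const t 1).div (hasDerivAt_id t) h0.ne').sub (hq.mul hL)) using 1
    rw [integral_mul_sqrt_div_sqrt h0 h1]
    have : d = (Real.log (1 + t) - Real.log (1 - t)) / t := by
      rw [← hd']; field_simp
    rw [this]
    simp
    field_simp
    ring
  have hG0 : ContinuousWithinAt G (Set.Icc 0 a) 0 := by
    obtain ⟨d, hd, -⟩ := hLi 0 (by simp)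
    refine hd.continuousAt.continuousWithinAt.sub ?_
    have hEeq : (fun t : ℝ => 1 / t - (1 - t ^ 2) / (2 * t ^ 2) *
        (Real.log (1 + t) - Real.log (1 - t))) = fun t =>
        (2 * t - (Real.log (1 + t) - Real.log (1 - t))) / (2 * t ^ 2) +
          (Real.log (1 + t) - Real.log (1 - t)) / 2 := by
      funext t
      rcases eq_or_ne t 0 with rfl | ht
      · simp
      · field_simp
        ring
    rw [hEeq]
    refine ContinuousWithinAt.add ?_ ?_
    · have hlim : Filter.Tendsto (fun t : ℝ => t / (1 - t)) (nhdsWithin 0 (Set.Icc 0 a))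
          (nhds 0) := by
        have : ContinuousAt (fun t : ℝ => t / (1 - t)) 0 :=
          ContinuousAt.div (by fun_prop) (by fun_prop) (by norm_num)
        simpa using this.continuousWithinAt.tendsto
      have hz := squeeze_zero_norm' (f := fun t : ℝ =>
        (2 * t - (Real.log (1 + t) - Real.log (1 - t))) / (2 * t ^ 2)) ?_ hlim
      · simpa [ContinuousWithinAt] using hz
      · filter_upwards [self_mem_nhdsWithin] with t ht
        rcases ht.1.eq_or_lt with rfl | h0
        · simp
        have h1 : 0 < 1 - t := by linarith [ht.2]
        have hb := Real.abs_log_sub_add_sum_range_le (x := t)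
          (by rw [abs_of_pos h0]; linarith) 2
        have hb' := Real.abs_log_sub_add_sum_range_le (x := -t)
          (by rw [abs_neg, abs_of_pos h0]; linarith) 2
        simp only [Finset.sum_range_succ, Finset.sum_range_zero, abs_neg, abs_of_pos h0,
          sub_neg_eq_add] at hb hb'
        norm_num at hb hb'
        rw [Real.norm_eq_abs, abs_div, abs_of_pos (by positivity : 0 < 2 * t ^ 2),
          div_le_iff₀ (by positivity)]
        have e : t / (1 - t) * (2 * t ^ 2) = t ^ 3 / (1 - t) + t ^ 3 / (1 - t) := by ring
        rw [e]
        rw [abs_le] at *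
        constructor <;> linarith [hb.1, hb.2, hb'.1, hb'.2]
    · have : ContinuousAt (fun t : ℝ => (Real.log (1 + t) - Real.log (1 - t)) / 2) 0 :=
        ((ContinuousAt.log (by fun_prop) (by norm_num)).sub
          (ContinuousAt.log (by fun_prop) (by norm_num))).div_const 2
      exact this.continuousWithinAt
  have hcont : ContinuousOn G (Set.Icc 0 a) := by
    intro t ht
    rcases ht.1.eq_or_lt with rfl | h
    · exact hG0
    · exact (hG t ⟨h, ht.2.trans_lt ha1⟩).continuousAt.continuousWithinAt
  have hder : ∀ t ∈ Set.Ioo 0 a, HasDerivAt G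
      (4 * ∫ x in (0 : ℝ)..1, √(1 - x ^ 2) * (x / √(1 - (t * x) ^ 2))) t :=
    fun t ht => hG t ⟨ht.1, ht.2.trans ha1⟩
  have hint := intervalIntegral.integral_eq_sub_of_hasDerivAt_of_le ha0.le hcont hder
    (intervalIntegral.intervalIntegrable_deriv_of_nonneg (by rwa [Set.uIcc_of_le ha0.le])
      (by simpa [ha0.le] using hder) ?_)
  · rw [intervalIntegral.integral_const_mul, ← integral_sqrt_mul_arcsin ha0 ha1] at hint
    rw [hint]
    simp [G]
    ring
  · intro t _
    refine mul_nonneg (by norm_num) (intervalIntegral.integral_nonneg zero_le_one fun x hx => ?_)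
    have := hx.1
    positivity

theorem stmt_3 :
    Li2 (Real.sqrt 2 - 1) - Li2 (1 - Real.sqrt 2) =
      4 * (∫ x in (0 : ℝ)..1, Real.sqrt (1 - x ^ 2) * Real.arcsin ((Real.sqrt 2 - 1) * x)) +
        (1 + Real.sqrt 2) * (1 + Real.log (2 - Real.sqrt 2) - Real.log 2 / 2) := by
  have hs : √2 ^ 2 = (2 : ℝ) := Real.sq_sqrt (by norm_num)
  have h1 : 1 < √2 := by rw [Real.lt_sqrt] <;> norm_num
  have h2 : √2 < 2 := by rw [Real.sqrt_lt'] <;> norm_num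
  have h := Li2_sub_Li2_neg_eq (a := √2 - 1) (by linarith) (by linarith)
  have hinv : 1 / (√2 - 1) = 1 + √2 := by
    rw [div_eq_iff (by linarith)]
    linear_combination -hs
  have hcoef : (1 - (√2 - 1) ^ 2) / (2 * (√2 - 1) ^ 2) = 1 + √2 := by
    have : (√2 - 1) ≠ 0 := by linarith
    rw [div_eq_iff (by positivity)]
    linear_combination (-2 * √2 + 1) * hs
  rw [hinv, hcoef, neg_sub, show 1 + (√2 - 1) = √2 by ring,
    show 1 - (√2 - 1) = 2 - √2 by ring, Real.log_sqrt (by norm_num)] at h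
  rw [h]
  ring
end

section
/- For real numbers a > 0 and b with 0 < a·b < 1, one has ∫₀^a √(a²−x²) · arcsin(bx) dx = (a/(4b)) · [ ((1−a²b²)/(2ab)) · ln((1+ab)/(1−ab)) + ab·(Li₂(ab) − Li₂(−ab)) − 1 ]. -/
open Real

open Set Filter Topology MeasureTheory

theorem Li2_zero : Li2 0 = 0 := by
  simp [Li2]

/-- The power series of `Li₂` may be differentiated term by term in the unit disc. -/
theorem hasDerivAt_Li2_s4 {z : ℝ} (hz : |z| < 1) :
    HasDerivAt Li2 (∑' k : ℕ, z ^ k / ((k : ℝ) + 1)) z := by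
  obtain ⟨r, hzr, hr1⟩ := exists_between hz
  have hr0 : 0 ≤ r := (abs_nonneg z).trans hzr.le
  have hmem : ∀ {y : ℝ}, y ∈ Ioo (-r) r ↔ |y| < r := fun {y} => abs_lt.symm
  refine hasDerivAt_tsum_of_isPreconnected (u := fun k : ℕ => r ^ k) (t := Ioo (-r) r)
    (g := fun (k : ℕ) (z : ℝ) => z ^ (k + 1) / ((k : ℝ) + 1) ^ 2)
    (g' := fun (k : ℕ) (z : ℝ) => z ^ k / ((k : ℝ) + 1)) (y₀ := 0)
    (summable_geometric_of_lt_one hr0 hr1) isOpen_Ioo isPreconnected_Ioo ?_ ?_ ?_ ?_ (hmem.2 hzr)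
  · intro k y _
    have hk : (k : ℝ) + 1 ≠ 0 := by positivity
    have h := (hasDerivAt_pow (k + 1) y).div_const (((k : ℝ) + 1) ^ 2)
    refine h.congr_deriv ?_
    push_cast
    field_simp
  · intro k y hy
    rw [norm_div, norm_pow, Real.norm_eq_abs, Real.norm_eq_abs,
      abs_of_pos (by positivity : (0 : ℝ) < k + 1)]
    calc |y| ^ k / ((k : ℝ) + 1) ≤ |y| ^ k :=
          div_le_self (by positivity) (by linarith [Nat.cast_nonneg (α := ℝ) k])
      _ ≤ r ^ k := by gcongr; exact (hmem.1 hy).le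
  · exact hmem.2 (by simpa using (abs_nonneg z).trans_lt hzr)
  · simp

/-- `Li₂'(z) = -log (1 - z) / z` for `0 < |z| < 1`. -/
theorem hasDerivAt_Li2_log {z : ℝ} (hz : |z| < 1) (hz0 : z ≠ 0) :
    HasDerivAt Li2 (-Real.log (1 - z) / z) z := by
  convert hasDerivAt_Li2_s4 hz using 1
  rw [← ((hasSum_pow_div_log_of_abs_lt_one hz).div_const z).tsum_eq]
  refine tsum_congr fun k => ?_
  field_simp
  ring

theorem one_sub_sq_mul_sq_pos {t s : ℝ} (ht : |t| < 1) (hs : s ∈ Icc (0 : ℝ) 1) :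
    0 < 1 - t ^ 2 * s ^ 2 := by
  have h1 : t ^ 2 < 1 := (sq_lt_one_iff_abs_lt_one t).2 ht
  have h2 : s ^ 2 ≤ 1 := pow_le_one₀ hs.1 hs.2
  nlinarith [sq_nonneg t, sq_nonneg s]

theorem hasDerivAt_integral_sqrt_mul_arcsin {t : ℝ} (ht : |t| < 1) :
    HasDerivAt (fun t => ∫ s in (0 : ℝ)..1, √(1 - s ^ 2) * arcsin (t * s))
      (∫ s in (0 : ℝ)..1, √(1 - s ^ 2) * (s / √(1 - t ^ 2 * s ^ 2))) t := by
  have hU : Ioo (-1 : ℝ) 1 ∈ 𝓝 t := isOpen_Ioo.mem_nhds (abs_lt.1 ht)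
  have hcont : ∀ x : ℝ, Continuous fun s : ℝ => √(1 - s ^ 2) * arcsin (x * s) := fun x => by
    have := continuous_arcsin
    fun_prop
  refine (intervalIntegral.hasDerivAt_integral_of_dominated_loc_of_deriv_le
    (F := fun t s => √(1 - s ^ 2) * arcsin (t * s))
    (F' := fun t s => √(1 - s ^ 2) * (s / √(1 - t ^ 2 * s ^ 2)))
    (bound := fun _ => 1) hU ?_ ?_ ?_ ?_ ?_ ?_).2
  · exact Eventually.of_forall fun x => (hcont x).aestronglyMeasurable
  · exact (hcont t).intervalIntegrable _ _
  · exact Measurable.aestronglyMeasurable (by fun_prop)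
  · refine Eventually.of_forall fun s hs x hx => ?_
    rw [uIoc_of_le zero_le_one] at hs
    have hpos := one_sub_sq_mul_sq_pos (abs_lt.2 hx) ⟨hs.1.le, hs.2⟩
    have hx2 : x ^ 2 ≤ 1 := ((sq_lt_one_iff_abs_lt_one x).2 (abs_lt.2 hx)).le
    have hle : √(1 - s ^ 2) ≤ √(1 - x ^ 2 * s ^ 2) :=
      Real.sqrt_le_sqrt (by nlinarith [sq_nonneg s])
    rw [Real.norm_of_nonneg (mul_nonneg (sqrt_nonneg _) (div_nonneg hs.1.le (sqrt_nonneg _))),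
      ← mul_div_assoc, div_le_one (sqrt_pos.2 hpos)]
    nlinarith [sqrt_nonneg (1 - s ^ 2), hs.2, hs.1]
  · exact intervalIntegrable_const
  · refine Eventually.of_forall fun s hs x hx => ?_
    rw [uIoc_of_le zero_le_one] at hs
    have hpos := one_sub_sq_mul_sq_pos (abs_lt.2 hx) ⟨hs.1.le, hs.2⟩
    have h1 : x * s ≠ -1 := fun h => by rw [← mul_pow, h] at hpos; norm_num at hpos
    have h2 : x * s ≠ 1 := fun h => by rw [← mul_pow, h] at hpos; norm_num at hpos
    have h := ((hasDerivAt_arcsin h1 h2).comp x ((hasDerivAt_id x).mul_const s)).const_mul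
      (√(1 - s ^ 2))
    refine h.congr_deriv ?_
    rw [mul_pow]
    ring

theorem log_one_add_div_one_sub {t : ℝ} (ht0 : 0 < t) (ht1 : t < 1) :
    Real.log ((1 + t) / (1 - t)) = Real.log (1 + t) - Real.log (1 - t) :=
  Real.log_div (by linarith) (by linarith)

theorem integral_sqrt_mul_div_sqrt {t : ℝ} (ht0 : 0 < t) (ht1 : t < 1) :
    ∫ s in (0 : ℝ)..1, √(1 - s ^ 2) * (s / √(1 - t ^ 2 * s ^ 2)) =
      1 / (2 * t ^ 2) - (1 - t ^ 2) / (4 * t ^ 3) * Real.log ((1 + t) / (1 - t)) := by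
  have habs : |t| < 1 := by rwa [abs_of_pos ht0]
  have hsq : ∀ s ∈ Icc (0 : ℝ) 1, 0 < √(1 - t ^ 2 * s ^ 2) := fun s hs =>
    sqrt_pos.2 (one_sub_sq_mul_sq_pos habs hs)
  have hlog : ∀ s ∈ Icc (0 : ℝ) 1, t * √(1 - s ^ 2) + √(1 - t ^ 2 * s ^ 2) ≠ 0 := fun s hs =>
    (add_pos_of_nonneg_of_pos (mul_nonneg ht0.le (sqrt_nonneg _)) (hsq s hs)).ne'
  have key := intervalIntegral.integral_eq_sub_of_hasDerivAt_of_le (zero_le_one' ℝ)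
    (f := fun s => -(√(1 - s ^ 2) * √(1 - t ^ 2 * s ^ 2)) / (2 * t ^ 2) +
      (1 - t ^ 2) / (2 * t ^ 3) * Real.log (t * √(1 - s ^ 2) + √(1 - t ^ 2 * s ^ 2)))
    (f' := fun s => √(1 - s ^ 2) * (s / √(1 - t ^ 2 * s ^ 2))) ?_ ?_ ?_
  · rw [key]
    have hc : √(1 - t ^ 2) = √(1 - t) * √(1 + t) := by
      rw [← Real.sqrt_mul (by linarith)]; ring_nf
    have hlc : Real.log √(1 - t ^ 2) = (Real.log (1 - t) + Real.log (1 + t)) / 2 := by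
      rw [Real.log_sqrt (by nlinarith), ← Real.log_mul (by linarith) (by linarith)]
      ring_nf
    rw [log_one_add_div_one_sub ht0 ht1]
    norm_num
    rw [hlc, add_comm t 1]
    field_simp
    ring
  · refine ContinuousOn.add (by fun_prop) (continuousOn_const.mul ?_)
    exact ContinuousOn.log (by fun_prop) hlog
  · intro s hs
    have hs' : s ∈ Icc (0 : ℝ) 1 := ⟨hs.1.le, hs.2.le⟩
    have hp : 0 < 1 - s ^ 2 := by nlinarith [hs.1, hs.2]
    have hq := one_sub_sq_mul_sq_pos habs hs'
    have d1 : HasDerivAt (fun s : ℝ => 1 - s ^ 2) (-(2 * s)) s := by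
      simpa using (hasDerivAt_pow 2 s).const_sub 1
    have d2 : HasDerivAt (fun s : ℝ => 1 - t ^ 2 * s ^ 2) (-(t ^ 2 * (2 * s))) s := by
      simpa using ((hasDerivAt_pow 2 s).const_mul (t ^ 2)).const_sub 1
    have e1 := d1.sqrt hp.ne'
    have e2 := d2.sqrt hq.ne'
    have h := ((e1.mul e2).neg.div_const (2 * t ^ 2)).add
      ((((e1.const_mul t).add e2).log (hlog s hs')).const_mul ((1 - t ^ 2) / (2 * t ^ 3)))
    refine h.congr_deriv ?_
    have hl := hlog s hs'
    have hP := Real.sq_sqrt hp.le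
    have hQ := Real.sq_sqrt hq.le
    have hP0 := sqrt_pos.2 hp
    have hQ0 := sqrt_pos.2 hq
    simp only [Pi.add_apply]
    generalize √(1 - s ^ 2) = p at *
    generalize √(1 - t ^ 2 * s ^ 2) = q at *
    have hr : (t * (-(2 * s) / (2 * p)) + -(t ^ 2 * (2 * s)) / (2 * q)) / (t * p + q) =
        -(t * s) / (p * q) := by
      field_simp
      ring
    rw [hr]
    have ht : t ^ 2 * p ^ 2 + 1 - t ^ 2 = q ^ 2 := by rw [hP, hQ]; ring
    field_simp
    linear_combination (-s) * ht
  · refine ContinuousOn.intervalIntegrable ?_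
    rw [uIcc_of_le zero_le_one]
    exact ContinuousOn.mul (by fun_prop)
      (continuousOn_id.div (by fun_prop) fun s hs => (hsq s hs).ne')

/-- The closed form of `∫₀¹ √(1 - s²) arcsin (t s) ds`; it takes the right value `0` at `t = 0`. -/
noncomputable def sqrtArcsinClosedForm (t : ℝ) : ℝ :=
  (1 - t ^ 2) / (8 * t ^ 2) * Real.log ((1 + t) / (1 - t)) + (Li2 t - Li2 (-t)) / 4 - 1 / (4 * t)

theorem sqrtArcsinClosedForm_zero : sqrtArcsinClosedForm 0 = 0 := by
  simp [sqrtArcsinClosedForm]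

theorem hasDerivAt_sqrtArcsinClosedForm {t : ℝ} (ht0 : 0 < t) (ht1 : t < 1) :
    HasDerivAt sqrtArcsinClosedForm
      (1 / (2 * t ^ 2) - (1 - t ^ 2) / (4 * t ^ 3) * Real.log ((1 + t) / (1 - t))) t := by
  have habs : |t| < 1 := by rwa [abs_of_pos ht0]
  have hm : 1 - t ≠ 0 := by linarith
  have hp : 1 + t ≠ 0 := by linarith
  have dp : HasDerivAt (fun t : ℝ => 1 + t) 1 t := (hasDerivAt_id t).const_add 1
  have dm : HasDerivAt (fun t : ℝ => 1 - t) (-1) t := (hasDerivAt_id t).const_sub 1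
  have dL := (dp.div dm hm).log (div_ne_zero hp hm)
  have d1 : HasDerivAt (fun t : ℝ => 1 - t ^ 2) (-(2 * t)) t := by
    simpa using (hasDerivAt_pow 2 t).const_sub 1
  have d2 : HasDerivAt (fun t : ℝ => 8 * t ^ 2) (8 * (2 * t)) t := by
    simpa using (hasDerivAt_pow 2 t).const_mul 8
  have d3 : HasDerivAt (fun t : ℝ => 4 * t) 4 t := by
    simpa using (hasDerivAt_id t).const_mul 4
  have dLi := hasDerivAt_Li2_log habs ht0.ne'
  have dLi' : HasDerivAt (fun t => Li2 (-t)) (-Real.log (1 - -t) / -t * -1) t :=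
    (hasDerivAt_Li2_log (z := -t) (by rwa [abs_neg]) (by simpa using ht0.ne')).comp t
      (hasDerivAt_neg t)
  have h := (((d1.div d2 (by positivity)).mul dL).add ((dLi.sub dLi').div_const 4)).sub
    ((hasDerivAt_const t (1 : ℝ)).div d3 (by positivity))
  refine h.congr_deriv ?_
  simp only [Pi.div_apply]
  rw [log_one_add_div_one_sub ht0 ht1, sub_neg_eq_add]
  field_simp
  ring

theorem abs_log_one_add_div_one_sub_sub_le {t : ℝ} (ht0 : 0 < t) (ht1 : t < 1) :
    |Real.log ((1 + t) / (1 - t)) - 2 * t| ≤ 2 * (t ^ 3 / (1 - t)) := by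
  have h1 := Real.abs_log_sub_add_sum_range_le (x := t) (by rwa [abs_of_pos ht0]) 2
  have h2 := Real.abs_log_sub_add_sum_range_le (x := -t) (by rwa [abs_neg, abs_of_pos ht0]) 2
  simp only [Finset.sum_range_succ, Finset.sum_range_zero, abs_neg, abs_of_pos ht0,
    sub_neg_eq_add] at h1 h2
  norm_num at h1 h2
  rw [log_one_add_div_one_sub ht0 ht1]
  rw [abs_le] at h1 h2 ⊢
  constructor <;> linarith [h1.1, h1.2, h2.1, h2.2]

theorem tendsto_sqrtArcsinClosedForm_zero :
    Tendsto sqrtArcsinClosedForm (𝓝[>] 0) (𝓝 0) := by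
  have hLi : ContinuousAt Li2 0 := (hasDerivAt_Li2_s4 (by simp)).continuousAt
  have hLi' : ContinuousAt (fun t => Li2 (-t)) 0 :=
    ContinuousAt.comp (g := Li2) (by rwa [neg_zero]) continuousAt_neg
  have h1 : Tendsto (fun t => (Li2 t - Li2 (-t)) / 4 - t / 4) (𝓝[>] 0) (𝓝 0) := by
    have : ContinuousAt (fun t => (Li2 t - Li2 (-t)) / 4 - t / 4) 0 :=
      ((hLi.sub hLi').div_const 4).sub (continuousAt_id.div_const 4)
    simpa [ContinuousAt, Li2_zero] using this.tendsto.mono_left nhdsWithin_le_nhds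
  have h2 : Tendsto (fun t : ℝ => (1 - t ^ 2) / (8 * t ^ 2) *
      (Real.log ((1 + t) / (1 - t)) - 2 * t)) (𝓝[>] 0) (𝓝 0) := by
    have hb : Tendsto (fun t : ℝ => t * (1 + t) / 4) (𝓝[>] 0) (𝓝 0) := by
      have : Continuous fun t : ℝ => t * (1 + t) / 4 := by fun_prop
      simpa using (this.tendsto 0).mono_left nhdsWithin_le_nhds
    refine squeeze_zero_norm' ?_ hb
    filter_upwards [Ioo_mem_nhdsGT (zero_lt_one' ℝ)] with t ht
    have h := abs_log_one_add_div_one_sub_sub_le ht.1 ht.2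
    have ht0 := ht.1
    have hm : 0 < 1 - t := by linarith [ht.2]
    have hc : 0 ≤ (1 - t ^ 2) / (8 * t ^ 2) := div_nonneg (by nlinarith) (by positivity)
    rw [norm_mul, Real.norm_of_nonneg hc, Real.norm_eq_abs]
    refine (mul_le_mul_of_nonneg_left h hc).trans_eq ?_
    field_simp
    ring
  have h := h1.add h2
  rw [add_zero] at h
  refine h.congr' ?_
  filter_upwards [self_mem_nhdsWithin] with t ht
  have ht0 : t ≠ 0 := (mem_Ioi.1 ht).ne'
  rw [sqrtArcsinClosedForm]
  field_simp
  ring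

theorem integral_sqrt_mul_arcsin_s4 {t : ℝ} (ht0 : 0 < t) (ht1 : t < 1) :
    ∫ s in (0 : ℝ)..1, √(1 - s ^ 2) * arcsin (t * s) = sqrtArcsinClosedForm t := by
  have hlt : ∀ x ∈ Icc 0 t, |x| < 1 := fun x hx => by
    rw [abs_of_nonneg hx.1]; exact hx.2.trans_lt ht1
  have hcont : ContinuousOn sqrtArcsinClosedForm (Icc 0 t) := by
    intro x hx
    rcases hx.1.eq_or_lt with rfl | hx0
    · have : ContinuousWithinAt sqrtArcsinClosedForm (Ioi 0) 0 := by
        simpa [ContinuousWithinAt, sqrtArcsinClosedForm_zero] using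
          tendsto_sqrtArcsinClosedForm_zero
      exact (continuousWithinAt_Ioi_iff_Ici.1 this).mono Icc_subset_Ici_self
    · exact (hasDerivAt_sqrtArcsinClosedForm hx0
        (hx.2.trans_lt ht1)).continuousAt.continuousWithinAt
  obtain ⟨c, hc, h⟩ := exists_hasDerivAt_eq_slope
    (fun t => (∫ s in (0 : ℝ)..1, √(1 - s ^ 2) * arcsin (t * s)) - sqrtArcsinClosedForm t)
    (fun _ => 0) ht0
    (ContinuousOn.sub (fun x hx =>
      (hasDerivAt_integral_sqrt_mul_arcsin (hlt x hx)).continuousAt.continuousWithinAt) hcont)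
    (fun x hx => by
      have hx1 : x < 1 := hx.2.trans ht1
      have h := (hasDerivAt_integral_sqrt_mul_arcsin (hlt x ⟨hx.1.le, hx.2.le⟩)).sub
        (hasDerivAt_sqrtArcsinClosedForm hx.1 hx1)
      rwa [integral_sqrt_mul_div_sqrt hx.1 hx1, sub_self] at h)
  rw [eq_div_iff (by linarith)] at h
  simp only [zero_mul, arcsin_zero, mul_zero, intervalIntegral.integral_zero,
    sqrtArcsinClosedForm_zero, sub_zero] at h
  linarith

theorem stmt_4 (a b : ℝ) (ha : 0 < a) (hab0 : 0 < a * b) (hab1 : a * b < 1) :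
    ∫ x in (0 : ℝ)..a, Real.sqrt (a ^ 2 - x ^ 2) * Real.arcsin (b * x) =
      a / (4 * b) *
        ((1 - a ^ 2 * b ^ 2) / (2 * a * b) * Real.log ((1 + a * b) / (1 - a * b)) +
          a * b * (Li2 (a * b) - Li2 (-(a * b))) - 1) := by
  have hb : 0 < b := pos_of_mul_pos_right hab0 ha.le
  have hscale := intervalIntegral.mul_integral_comp_mul_left (a := 0) (b := 1)
    (f := fun x => √(a ^ 2 - x ^ 2) * arcsin (b * x)) a
  rw [mul_zero, mul_one] at hscale
  have hfun : ∀ s : ℝ, √(a ^ 2 - (a * s) ^ 2) * arcsin (b * (a * s)) =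
      a * (√(1 - s ^ 2) * arcsin (a * b * s)) := fun s => by
    rw [show a ^ 2 - (a * s) ^ 2 = a ^ 2 * (1 - s ^ 2) by ring, Real.sqrt_mul (sq_nonneg a),
      Real.sqrt_sq ha.le, show b * (a * s) = a * b * s by ring, mul_assoc]
  rw [← hscale]
  simp only [hfun]
  rw [intervalIntegral.integral_const_mul, integral_sqrt_mul_arcsin_s4 hab0 hab1,
    sqrtArcsinClosedForm]
  generalize Real.log ((1 + a * b) / (1 - a * b)) = L
  field_simp
  ring
end

section
/- Valdebenito's first identity: π² = 4·(ln(1+√2))² − 16·∫_{ln(1+√2)/2}^{∞} ln(tanh x) dx. -/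
open Real

theorem summable_one_div_odd_sq : Summable fun n : ℕ => 1 / (2 * (n : ℝ) + 1) ^ 2 := by
  have h := hasSum_zeta_two.summable.comp_injective
    (i := fun n : ℕ => 2 * n + 1) (fun a b hab => by simpa using hab)
  refine h.congr fun n => ?_
  simp

theorem tsum_one_div_odd_sq : ∑' n : ℕ, 1 / (2 * (n : ℝ) + 1) ^ 2 = π ^ 2 / 8 := by
  have heven : HasSum (fun n : ℕ => (1 : ℝ) / ((2 * n : ℕ) : ℝ) ^ 2) (π ^ 2 / 24) := by
    have h := hasSum_zeta_two.mul_left (1 / 4)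
    rw [show 1 / 4 * (π ^ 2 / 6) = π ^ 2 / 24 by ring] at h
    refine h.congr_fun fun n => ?_
    push_cast
    ring
  have hodd : HasSum (fun n : ℕ => (1 : ℝ) / ((2 * n + 1 : ℕ) : ℝ) ^ 2)
      (∑' n : ℕ, 1 / (2 * (n : ℝ) + 1) ^ 2) := by
    simpa using summable_one_div_odd_sq.hasSum
  have h := (HasSum.even_add_odd (f := fun n : ℕ => (1 : ℝ) / (n : ℝ) ^ 2)
    heven hodd).unique hasSum_zeta_two
  linarith

/-- The Legendre chi function of order two. -/
noncomputable def legendreChi (t : ℝ) : ℝ := ∑' n : ℕ, t ^ (2 * n + 1) / (2 * (n : ℝ) + 1) ^ 2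

theorem legendreChi_zero : legendreChi 0 = 0 := by
  simp [legendreChi]

theorem legendreChi_one : legendreChi 1 = π ^ 2 / 8 := by
  simpa [legendreChi] using tsum_one_div_odd_sq

theorem norm_legendreChi_term_le {t : ℝ} (ht : |t| ≤ 1) (n : ℕ) :
    ‖t ^ (2 * n + 1) / (2 * (n : ℝ) + 1) ^ 2‖ ≤ 1 / (2 * (n : ℝ) + 1) ^ 2 := by
  rw [norm_div, norm_pow, Real.norm_eq_abs, Real.norm_of_nonneg (by positivity)]
  gcongr
  exact pow_le_one₀ (abs_nonneg t) ht

theorem continuousOn_legendreChi : ContinuousOn legendreChi (Set.Icc (-1) 1) :=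
  continuousOn_tsum (fun n => by fun_prop) summable_one_div_odd_sq
    fun n _ ht => norm_legendreChi_term_le (abs_le.2 ht) n

theorem hasDerivAt_legendreChi {t : ℝ} (h0 : 0 < t) (h1 : t < 1) :
    HasDerivAt legendreChi ((log (1 + t) - log (1 - t)) / (2 * t)) t := by
  obtain ⟨r, htr, hr1⟩ := exists_between h1
  have hr0 : 0 < r := h0.trans htr
  have hsum : Summable fun n : ℕ => (r ^ 2) ^ n :=
    summable_geometric_of_lt_one (by positivity) (by nlinarith)
  have hd := hasDerivAt_tsum_of_isPreconnected (t := Set.Ioo (-r) r) (y₀ := 0) (y := t)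
    (g := fun (n : ℕ) (x : ℝ) => x ^ (2 * n + 1) / (2 * (n : ℝ) + 1) ^ 2)
    (g' := fun (n : ℕ) (x : ℝ) => x ^ (2 * n) / (2 * (n : ℝ) + 1))
    hsum isOpen_Ioo isPreconnected_Ioo ?_ ?_ ⟨by linarith, hr0⟩ (by simp)
    ⟨by linarith, htr⟩
  · refine hd.congr_deriv ?_
    have hlog := Real.hasSum_log_sub_log_of_abs_lt_one (x := t) (abs_lt.2 ⟨by linarith, h1⟩)
    rw [← (hlog.div_const (2 * t)).tsum_eq]
    refine tsum_congr fun n => ?_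
    field_simp
    ring
  · intro n x _
    refine ((hasDerivAt_pow (2 * n + 1) x).div_const ((2 * (n : ℝ) + 1) ^ 2)).congr_deriv ?_
    push_cast
    field_simp
  · intro n x hx
    rw [norm_div, norm_pow, Real.norm_eq_abs, Real.norm_of_nonneg (by positivity), ← pow_mul]
    refine (div_le_self (by positivity) (by linarith [n.cast_nonneg (α := ℝ)])).trans ?_
    gcongr
    exact (abs_lt.2 hx).le

theorem continuousAt_log_mul_log_sub_log :
    ContinuousAt (fun t : ℝ => log t * (log (1 + t) - log (1 - t))) 0 := by
  have hd : HasDerivAt (fun t : ℝ => log (1 + t) - log (1 - t)) (1 / (1 + 0) - -1 / (1 - 0)) 0 :=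
    (((hasDerivAt_id (0 : ℝ)).const_add 1).log (by norm_num)).sub
      (((hasDerivAt_id (0 : ℝ)).const_sub 1).log (by norm_num))
  have hO := hd.isBigO_sub
  simp only [add_zero, sub_zero, log_one, sub_self] at hO
  have hlim : Filter.Tendsto (fun t : ℝ => log t * t) (nhds 0) (nhds 0) := by
    simpa [mul_comm] using continuous_mul_log.tendsto 0
  have h := ((Asymptotics.isBigO_refl log (nhds 0)).mul hO).trans_tendsto hlim
  simpa [ContinuousAt] using h

/-- The reflection formula for the Legendre chi function. -/
theorem legendreChi_add_legendreChi {s : ℝ} (h0 : 0 < s) (h1 : s < 1) :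
    legendreChi s + legendreChi ((1 - s) / (1 + s)) =
      π ^ 2 / 8 + log s * (log (1 + s) - log (1 - s)) / 2 := by
  have hcont : ContinuousOn (fun t => legendreChi t + legendreChi ((1 - t) / (1 + t)) -
      log t * (log (1 + t) - log (1 - t)) / 2) (Set.Icc 0 s) := by
    refine ContinuousOn.sub (ContinuousOn.add ?_ ?_) (ContinuousOn.div_const ?_ 2)
    · exact continuousOn_legendreChi.mono (Set.Icc_subset_Icc (by norm_num) h1.le)
    · refine continuousOn_legendreChi.comp (t := Set.Icc (-1) 1) ?_ ?_
      · exact ContinuousOn.div (by fun_prop) (by fun_prop) fun t ht => by linarith [ht.1]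
      · intro t ht
        have : 0 < 1 + t := by linarith [ht.1]
        constructor
        · rw [le_div_iff₀ this]; linarith
        · rw [div_le_iff₀ this]; linarith [ht.1]
    · intro t ht
      rcases ht.1.eq_or_lt with rfl | htpos
      · exact continuousAt_log_mul_log_sub_log.continuousWithinAt
      · have hp : 1 + t ≠ 0 := by linarith
        have hm : 1 - t ≠ 0 := by linarith [ht.2]
        have ht0 : t ≠ 0 := htpos.ne'
        exact ContinuousAt.continuousWithinAt (by fun_prop (disch := assumption))
  have hderiv : ∀ t ∈ Set.Ioo 0 s, HasDerivAt (fun t => legendreChi t +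
      legendreChi ((1 - t) / (1 + t)) - log t * (log (1 + t) - log (1 - t)) / 2) 0 t := by
    intro t ht
    have ht0 : 0 < t := ht.1
    have hp : 0 < 1 + t := by linarith
    have hm : 0 < 1 - t := by linarith [ht.2]
    have dp := (hasDerivAt_id t).const_add 1
    have dm := (hasDerivAt_id t).const_sub 1
    have hchi := (hasDerivAt_legendreChi (div_pos hm hp)
      ((div_lt_one hp).2 (by linarith))).comp t (dm.div dp hp.ne')
    have hlog := ((hasDerivAt_log ht0.ne').mul
      ((dp.log hp.ne').sub (dm.log hm.ne'))).div_const 2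
    refine (((hasDerivAt_legendreChi ht0 (by linarith)).add hchi).sub hlog).congr_deriv ?_
    simp only [id, Pi.sub_apply]
    have e1 : 1 + (1 - t) / (1 + t) = 2 / (1 + t) := by field_simp; ring
    have e2 : 1 - (1 - t) / (1 + t) = 2 * t / (1 + t) := by field_simp; ring
    rw [e1, e2, log_div two_ne_zero hp.ne', log_div (by positivity) hp.ne',
      log_mul two_ne_zero ht0.ne']
    field_simp
    ring
  obtain ⟨c, -, hc⟩ := exists_hasDerivAt_eq_slope _ _ h0 hcont hderiv
  rw [eq_comm, div_eq_zero_iff, or_iff_left (by linarith)] at hc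
  simp only [legendreChi_zero, sub_zero, add_zero, div_one, legendreChi_one, log_zero,
    zero_mul, zero_div, zero_add] at hc
  linarith

theorem sqrt_two_sub_one_eq_exp : √2 - 1 = exp (-log (1 + √2)) := by
  rw [exp_neg, exp_log (by positivity), ← one_div, eq_div_iff (by positivity)]
  nlinarith [Real.sq_sqrt (show (0 : ℝ) ≤ 2 by norm_num)]

theorem log_tanh {x : ℝ} (hx : 0 < x) :
    log (tanh x) = log (1 - exp (-2 * x)) - log (1 + exp (-2 * x)) := by
  have h : exp (-2 * x) < 1 := exp_lt_one_iff.2 (by linarith)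
  rw [← log_div (by linarith) (by positivity), tanh_eq]
  have hm : exp (-2 * x) = exp (-x) * exp (-x) := by rw [← exp_add]; ring_nf
  have he : exp x * exp (-x) = 1 := by rw [← exp_add]; simp
  congr 1
  rw [hm, div_eq_div_iff (by positivity) (by positivity)]
  linear_combination 2 * exp (-x) * he

theorem integral_Ioi_log_tanh {a : ℝ} (ha : 0 < a) :
    ∫ x in Set.Ioi a, log (tanh x) = -legendreChi (exp (-2 * a)) := by
  have hderiv : ∀ x ∈ Set.Ici a,
      HasDerivAt (fun x => legendreChi (exp (-2 * x))) (log (tanh x)) x := by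
    intro x hx
    have hx0 : 0 < x := ha.trans_le hx
    refine ((hasDerivAt_legendreChi (exp_pos (-2 * x)) (exp_lt_one_iff.2 (by linarith))).comp x
      ((hasDerivAt_id x).const_mul (-2)).exp).congr_deriv ?_
    rw [log_tanh hx0]
    simp only [id]
    field_simp
    ring
  have hlim : Filter.Tendsto (fun x : ℝ => legendreChi (exp (-2 * x))) Filter.atTop (nhds 0) := by
    have hexp : Filter.Tendsto (fun x : ℝ => exp (-2 * x)) Filter.atTop (nhds 0) :=
      tendsto_exp_atBot.comp (Filter.tendsto_id.const_mul_atTop_of_neg (by norm_num))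
    have hc := (continuousOn_legendreChi.continuousAt
      (Icc_mem_nhds (by norm_num : (-1 : ℝ) < 0) one_pos)).tendsto.comp hexp
    rwa [legendreChi_zero] at hc
  rw [MeasureTheory.integral_Ioi_of_hasDerivAt_of_nonpos' hderiv (fun x hx => ?_) hlim, zero_sub]
  refine log_nonpos ?_ (tanh_lt_one x).le
  rw [tanh_eq_sinh_div_cosh]
  exact div_nonneg (sinh_nonneg_iff.2 (ha.trans hx).le) (cosh_pos x).le

theorem stmt_8 :
    Real.pi ^ 2 =
      4 * (Real.log (1 + Real.sqrt 2)) ^ 2 -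
        16 * ∫ x in Set.Ioi (Real.log (1 + Real.sqrt 2) / 2), Real.log (Real.tanh x) := by
  have hsq : √2 ^ 2 = 2 := Real.sq_sqrt (by norm_num)
  have hlt : 1 < √2 := Real.one_lt_sqrt_two
  have hlt' : √2 < 2 := by nlinarith
  have hL : 0 < log (1 + √2) := log_pos (by linarith)
  have hfix : (1 - (√2 - 1)) / (1 + (√2 - 1)) = √2 - 1 := by
    rw [div_eq_iff (by linarith)]
    linarith
  have hlog : log (√2 - 1) = -log (1 + √2) := by rw [sqrt_two_sub_one_eq_exp, log_exp]
  have h := legendreChi_add_legendreChi (s := √2 - 1) (by linarith) (by linarith)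
  rw [← neg_sub (log (1 - _)), ← log_div (by linarith) (by linarith), hfix, hlog] at h
  rw [integral_Ioi_log_tanh (by linarith),
    show -2 * (log (1 + √2) / 2) = -log (1 + √2) by ring, ← sqrt_two_sub_one_eq_exp]
  linarith
end

section
/- For real numbers a > 0 and b with 0 < a·b < 1, one has ∫₀^a arcsin(bx)/√(a²−x²) dx = (1/4)·[ 4·Li₂(ab) − Li₂(a²b²) ]. -/
open Real

open MeasureTheory Set

lemma one_sub_mul_sin_sq_pos {t : ℝ} (ht0 : 0 ≤ t) (ht1 : t < 1) (θ : ℝ) :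
    0 < 1 - (t * sin θ) ^ 2 := by
  have h : t ^ 2 < 1 := by nlinarith
  have h' : t ^ 2 * sin θ ^ 2 ≤ t ^ 2 * 1 :=
    mul_le_mul_of_nonneg_left (sin_sq_le_one θ) (sq_nonneg t)
  nlinarith

/-- The substitution `x = a sin θ`. -/
lemma integral_div_sqrt_sq_sub_sq {a : ℝ} (ha : 0 < a) (f : ℝ → ℝ) :
    ∫ x in (0 : ℝ)..a, f x / √(a ^ 2 - x ^ 2) = ∫ θ in (0 : ℝ)..(π / 2), f (a * sin θ) := by
  have hpi := pi_pos
  have himage : (fun θ => a * sin θ) '' Ioo 0 (π / 2) = Ioo 0 a := by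
    ext x
    constructor
    · rintro ⟨θ, ⟨h0, h1⟩, rfl⟩
      have hs : 0 < sin θ := sin_pos_of_pos_of_lt_pi h0 (by linarith)
      have hc : 0 < cos θ := cos_pos_of_mem_Ioo ⟨by linarith, h1⟩
      have hs1 : sin θ < 1 := by nlinarith [sin_sq_add_cos_sq θ]
      exact ⟨by positivity, by nlinarith⟩
    · rintro ⟨h0, h1⟩
      have hx1 : x / a < 1 := (div_lt_one ha).2 h1
      have hx0 : 0 < x / a := by positivity
      refine ⟨arcsin (x / a), ⟨arcsin_pos.2 hx0, arcsin_lt_pi_div_two.2 hx1⟩, ?_⟩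
      simp only
      rw [sin_arcsin (by linarith) hx1.le]
      field_simp
  rw [intervalIntegral.integral_of_le ha.le, intervalIntegral.integral_of_le (by positivity),
    integral_Ioc_eq_integral_Ioo, integral_Ioc_eq_integral_Ioo, ← himage,
    integral_image_eq_integral_abs_deriv_smul (f' := fun θ => a * cos θ) measurableSet_Ioo]
  · refine setIntegral_congr_fun measurableSet_Ioo fun θ hθ => ?_
    have hc : 0 < cos θ := cos_pos_of_mem_Ioo ⟨by linarith [hθ.1], hθ.2⟩
    have hsq : a ^ 2 - (a * sin θ) ^ 2 = (a * cos θ) ^ 2 := by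
      rw [mul_pow, mul_pow, cos_sq']; ring
    simp only [smul_eq_mul]
    rw [hsq, sqrt_sq (by positivity), abs_of_pos (by positivity)]
    field_simp
  · exact fun θ _ => ((hasDerivAt_sin θ).const_mul a).hasDerivWithinAt
  · intro x hx y hy hxy
    exact injOn_sin ⟨by linarith [hx.1], hx.2.le⟩ ⟨by linarith [hy.1], hy.2.le⟩
      (mul_left_cancel₀ ha.ne' hxy)

lemma arcsin_mul_sin_eq_integral {c : ℝ} (hc0 : 0 ≤ c) (hc1 : c < 1) (θ : ℝ) :
    arcsin (c * sin θ) = ∫ t in (0 : ℝ)..c, sin θ / √(1 - (t * sin θ) ^ 2) := by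
  rw [intervalIntegral.integral_eq_sub_of_hasDerivAt (f := fun t => arcsin (t * sin θ))]
  · simp
  · intro t ht
    rw [uIcc_of_le hc0] at ht
    have h := one_sub_mul_sin_sq_pos ht.1 (ht.2.trans_lt hc1) θ
    have := (hasDerivAt_arcsin (x := t * sin θ) (by rintro h'; simp [h'] at h)
      (by rintro h'; simp [h'] at h)).comp t ((hasDerivAt_id t).mul_const (sin θ))
    convert! this using 1
    ring
  · refine ContinuousOn.intervalIntegrable fun t ht => ContinuousAt.continuousWithinAt ?_
    rw [uIcc_of_le hc0] at ht
    have h := one_sub_mul_sin_sq_pos ht.1 (ht.2.trans_lt hc1) θ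
    exact ContinuousAt.div (by fun_prop) (by fun_prop) (sqrt_pos.2 h).ne'

lemma integral_sin_div_sqrt {t : ℝ} (ht0 : 0 < t) (ht1 : t < 1) :
    ∫ θ in (0 : ℝ)..(π / 2), sin θ / √(1 - (t * sin θ) ^ 2) =
      (log (1 + t) - log (1 - t)) / (2 * t) := by
  have hpos := one_sub_mul_sin_sq_pos ht0.le ht1
  have hpi := pi_pos
  rw [intervalIntegral.integral_eq_sub_of_hasDerivAt
    (f := fun θ => -(1 / t) * log (t * cos θ + √(1 - (t * sin θ) ^ 2)))]
  · have h : √(1 - t ^ 2) = √((1 - t) * (1 + t)) := by ring_nf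
    simp only [cos_pi_div_two, sin_pi_div_two, cos_zero, sin_zero, mul_zero, mul_one, zero_add]
    rw [h, log_sqrt (by nlinarith), log_mul (by linarith) (by linarith)]
    norm_num
    rw [add_comm t 1]
    field_simp
    ring
  · intro θ hθ
    rw [uIcc_of_le (by positivity)] at hθ
    have hc : 0 ≤ cos θ := cos_nonneg_of_mem_Icc ⟨by linarith [hθ.1], hθ.2⟩
    have hR := sqrt_pos.2 (hpos θ)
    have hden : 0 < t * cos θ + √(1 - (t * sin θ) ^ 2) := by positivity
    have hsqrt := ((((hasDerivAt_sin θ).const_mul t).pow 2).const_sub 1).sqrt (hpos θ).ne'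
    have := ((((hasDerivAt_cos θ).const_mul t).add hsqrt).log hden.ne').const_mul (-(1 / t))
    convert! this using 1
    simp only [Pi.add_apply, Pi.pow_apply]
    generalize √(1 - (t * sin θ) ^ 2) = R at hR hden ⊢
    push_cast
    field_simp
    ring
  · exact Continuous.intervalIntegrable
      (Continuous.div (by fun_prop) (by fun_prop) fun θ => (sqrt_pos.2 (hpos θ)).ne') _ _

lemma hasSum_integral_log_sub_log_div {c : ℝ} (hc0 : 0 ≤ c) (hc1 : c < 1) :
    HasSum (fun k : ℕ => c ^ (2 * k + 1) / (2 * (k : ℝ) + 1) ^ 2)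
      (∫ t in (0 : ℝ)..c, (log (1 + t) - log (1 - t)) / (2 * t)) := by
  have key := intervalIntegral.hasSum_integral_of_dominated_convergence (μ := volume)
    (a := 0) (b := c) (F := fun (k : ℕ) t => t ^ (2 * k) / (2 * (k : ℝ) + 1))
    (f := fun t => (log (1 + t) - log (1 - t)) / (2 * t))
    (fun k _ => (c ^ 2) ^ k) (fun k => by fun_prop) ?_ ?_ ?_ ?_
  · convert! key using 2 with k
    rw [intervalIntegral.integral_div, integral_pow]
    push_cast
    rw [zero_pow (by positivity)]
    field_simp
    ring
  · refine fun k => Filter.Eventually.of_forall fun t ht => ?_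
    rw [uIoc_of_le hc0] at ht
    have ht0 := ht.1.le
    rw [norm_of_nonneg (by positivity), ← pow_mul]
    refine (div_le_self (by positivity) ?_).trans (pow_le_pow_left₀ ht0 ht.2 _)
    linarith [(Nat.cast_nonneg k : (0 : ℝ) ≤ k)]
  · exact Filter.Eventually.of_forall fun t _ =>
      summable_geometric_of_lt_one (sq_nonneg c) (by nlinarith)
  · exact intervalIntegrable_const
  · refine Filter.Eventually.of_forall fun t ht => ?_
    rw [uIoc_of_le hc0] at ht
    have ht0 := ht.1
    have h := (hasSum_log_sub_log_of_abs_lt_one (x := t)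
      (by rw [abs_of_pos ht0]; exact ht.2.trans_lt hc1)).div_const (2 * t)
    convert! h using 2 with k
    field_simp
    ring

lemma integral_arcsin_mul_sin {c : ℝ} (hc0 : 0 ≤ c) (hc1 : c < 1) :
    ∫ θ in (0 : ℝ)..(π / 2), arcsin (c * sin θ) =
      ∫ t in (0 : ℝ)..c, (log (1 + t) - log (1 - t)) / (2 * t) := by
  simp_rw [arcsin_mul_sin_eq_integral hc0 hc1]
  rw [intervalIntegral_intervalIntegral_swap]
  · refine intervalIntegral.integral_congr_Ioo_of_le hc0 fun t ht => ?_
    exact integral_sin_div_sqrt ht.1 (ht.2.trans hc1)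
  · refine IntegrableOn.mono_set ?_ (prod_mono uIoc_subset_uIcc uIoc_subset_uIcc)
    refine ContinuousOn.integrableOn_compact (isCompact_uIcc.prod isCompact_uIcc) ?_
    rintro ⟨θ, t⟩ ⟨-, ht⟩
    refine ContinuousAt.continuousWithinAt ?_
    rw [uIcc_of_le hc0] at ht
    have h := one_sub_mul_sin_sq_pos ht.1 (ht.2.trans_lt hc1) θ
    exact ContinuousAt.div (by fun_prop) (by fun_prop) (sqrt_pos.2 h).ne'

lemma hasSum_Li2 {z : ℝ} (hz : |z| ≤ 1) :
    HasSum (fun k : ℕ => z ^ (k + 1) / ((k : ℝ) + 1) ^ 2) (Li2 z) := by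
  refine Summable.hasSum (Summable.of_norm_bounded (g := fun k : ℕ => 1 / ((k : ℝ) + 1) ^ 2) ?_ ?_)
  · exact_mod_cast (summable_nat_add_iff 1).2 (summable_one_div_nat_pow.2 one_lt_two)
  · intro k
    rw [norm_div, norm_pow, norm_of_nonneg (by positivity : (0 : ℝ) ≤ ((k : ℝ) + 1) ^ 2)]
    gcongr
    exact pow_le_one₀ (norm_nonneg z) hz

lemma Li2_eq_add {z : ℝ} (hz : |z| ≤ 1) {s : ℝ}
    (hs : HasSum (fun k : ℕ => z ^ (2 * k + 1) / (2 * (k : ℝ) + 1) ^ 2) s) :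
    Li2 z = s + Li2 (z ^ 2) / 4 := by
  have hz2 : |z ^ 2| ≤ 1 := by
    rw [abs_pow]
    exact pow_le_one₀ (abs_nonneg z) hz
  refine (hasSum_Li2 hz).unique (HasSum.even_add_odd (by simpa using hs) ?_)
  convert! (hasSum_Li2 hz2).div_const 4 using 2 with k
  push_cast
  rw [← pow_mul]
  field_simp
  ring

theorem stmt_11 (a b : ℝ) (ha : 0 < a) (hab0 : 0 < a * b) (hab1 : a * b < 1) :
    ∫ x in (0 : ℝ)..a, Real.arcsin (b * x) / Real.sqrt (a ^ 2 - x ^ 2) =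
      (1 / 4) * (4 * Li2 (a * b) - Li2 (a ^ 2 * b ^ 2)) := by
  have hLi := Li2_eq_add (by rw [abs_of_pos hab0]; exact hab1.le)
    (hasSum_integral_log_sub_log_div hab0.le hab1)
  rw [integral_div_sqrt_sq_sub_sq ha (fun x => arcsin (b * x)), ← mul_pow, hLi,
    ← integral_arcsin_mul_sin hab0.le hab1]
  simp_rw [← mul_assoc, mul_comm b a]
  ring
end
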